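/- arXiv:1706.03732 — 3 statements merged into one kernel-verified Lean document; each statement's English description precedes it below -/
import Mathlib

section
/- Let V be a real inner product space, let H : V → V be a symmetric linear map (i.e. ⟨H u, v⟩ = ⟨u, H v⟩ for all u, v ∈ V) satisfying ⟨H w, w⟩ < 3 ‖w‖² for every nonzero w ∈ V, and let J ∈ V. Set J̄ = J − (1/2) H J. Then ⟨J̄, J̄⟩ + ⟨H J̄, J̄⟩ ≤ ‖J‖². -/
open scoped RealInnerProductSpace

/-- Analytic core of Proposition 3.1: if the symmetric linear map `H` satisfies
`⟪H w, w⟫ < 3‖w‖²` for all nonzero `w`, then for `J̄ = J - (1/2) H J` one has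
`⟪J̄, J̄⟫ + ⟪H J̄, J̄⟫ ≤ ‖J‖²`. -/
theorem stmt1 {V : Type*} [NormedAddCommGroup V] [InnerProductSpace ℝ V]
    (H : V →ₗ[ℝ] V) (hH : ∀ u v : V, ⟪H u, v⟫ = ⟪u, H v⟫)
    (hbound : ∀ w : V, w ≠ 0 → ⟪H w, w⟫ < 3 * ‖w‖ ^ 2) (J : V) :
    ⟪J - (1/2 : ℝ) • H J, J - (1/2 : ℝ) • H J⟫
      + ⟪H (J - (1/2 : ℝ) • H J), J - (1/2 : ℝ) • H J⟫
    ≤ ‖J‖ ^ 2 := by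
  have hw : ⟪H (H J), H J⟫ ≤ 3 * ⟪H J, H J⟫ := by
    rw [real_inner_self_eq_norm_sq]
    by_cases h : H J = 0
    · simp [h]
    · exact (hbound _ h).le
  have hJ : ⟪H (H J), J⟫ = ⟪H J, H J⟫ := hH (H J) J
  have hc : ⟪J, H J⟫ = ⟪H J, J⟫ := real_inner_comm _ _
  rw [← real_inner_self_eq_norm_sq]
  simp only [map_sub, map_smul, inner_sub_left, inner_sub_right, real_inner_smul_left,
    real_inner_smul_right, hJ, hc]
  linarith
end

section
/- Let n ≥ 2 and r > 0. Let A be a continuously differentiable vector field defined on an open neighborhood of the sphere S_r = {x ∈ ℝⁿ : |x| = r}, and suppose x · A(x) = 0 for every x in that neighborhood. Then ∫_{S_r} div A dH^{n−1} = 0, where div A = Σ_j ∂_j A_j is the Euclidean divergence. -/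
open MeasureTheory
open scoped ENNReal

/-- The Euclidean sphere of dimension `m` has finite `m`-dimensional Hausdorff measure: it is
covered by the radial projections of the faces of a cube, which are Lipschitz. -/
theorem hausdorffMeasure_sphere_lt_top (m : ℕ) {r : ℝ} (hr : 0 < r) :
    μH[(m : ℝ)] (Metric.sphere (0 : EuclideanSpace ℝ (Fin (m + 1))) r) < ∞ := by
  classical
  let g : Fin (m + 1) → ℝ → (Fin m → ℝ) → EuclideanSpace ℝ (Fin (m + 1)) :=
    fun j s z => WithLp.toLp 2 (j.insertNth (α := fun _ => ℝ) s z)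
  let F : Fin (m + 1) → ℝ → (Fin m → ℝ) → EuclideanSpace ℝ (Fin (m + 1)) := fun j s z => (r / ‖g j s z‖) • g j s z
  have hg : ∀ j s, ContDiff ℝ 1 (g j s) := by
    intro j s
    rw [contDiff_euclidean]
    intro i
    rcases Fin.eq_self_or_eq_succAbove j i with rfl | ⟨k, rfl⟩
    · simpa [g] using contDiff_const
    · simpa [g] using contDiff_apply ℝ ℝ k
  have hg0 : ∀ j s, s ≠ 0 → ∀ z, g j s z ≠ 0 := by
    intro j s hs z h
    apply hs
    simpa [g] using congrArg (fun v : EuclideanSpace ℝ (Fin (m + 1)) => v j) h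
  have hF : ∀ j s, s ≠ 0 → ContDiff ℝ 1 (F j s) := fun j s hs =>
    (contDiff_const.div ((hg j s).norm ℝ (hg0 j s hs))
      fun z => norm_ne_zero_iff.2 (hg0 j s hs z)).smul (hg j s)
  have hfin : ∀ j s, s ≠ 0 → μH[(m : ℝ)] (F j s '' Set.Icc (-1) 1) < ∞ := by
    intro j s hs
    obtain ⟨K, hK⟩ := ((hF j s hs).locallyLipschitz.locallyLipschitzOn
      (s := Set.Icc (-1) 1)).exists_lipschitzOnWith_of_compact isCompact_Icc
    refine (hK.hausdorffMeasure_image_le m.cast_nonneg).trans_lt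
      (ENNReal.mul_lt_top (by simp) ?_)
    have := hausdorffMeasure_pi_real (ι := Fin m)
    rw [Fintype.card_fin] at this
    rw [this]
    exact isCompact_Icc.measure_lt_top
  have hcover : Metric.sphere (0 : EuclideanSpace ℝ (Fin (m + 1))) r ⊆
      ⋃ j, (F j 1 '' Set.Icc (-1) 1 ∪ F j (-1) '' Set.Icc (-1) 1) := by
    intro x hx
    have hxr : ‖x‖ = r := by simpa using hx
    obtain ⟨j, hj⟩ := Finite.exists_max fun i => |x i|
    have hM : 0 < |x j| := by
      refine (abs_nonneg _).lt_of_ne' fun h0 => ?_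
      have : x = 0 := by
        ext i
        simpa using (hj i).trans h0.le
      rw [this, norm_zero] at hxr
      exact hr.ne hxr
    have key : ∀ s : ℝ, x j = s * |x j| → x ∈ F j s '' Set.Icc (-1) 1 := by
      intro s hs
      have hgx : g j s (fun k => x (j.succAbove k) / |x j|) = |x j|⁻¹ • x := by
        ext i
        rcases Fin.eq_self_or_eq_succAbove j i with rfl | ⟨k, rfl⟩
        · simp only [g, Fin.insertNth_apply_same, PiLp.smul_apply, smul_eq_mul]
          field_simp
          exact hs.symm
        · simp [g, div_eq_inv_mul]
      refine ⟨fun k => x (j.succAbove k) / |x j|, ⟨fun k => ?_, fun k => ?_⟩, ?_⟩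
      · have := (abs_le.1 (hj (j.succAbove k))).1
        simp only [Pi.neg_apply, Pi.one_apply]
        rw [le_div_iff₀ hM]
        linarith
      · have := (abs_le.1 (hj (j.succAbove k))).2
        simp only [Pi.one_apply]
        rw [div_le_iff₀ hM]
        linarith
      · simp only [F, hgx, norm_smul, hxr, smul_smul, norm_inv, Real.norm_eq_abs, abs_abs]
        have : r / (|x j|⁻¹ * r) * |x j|⁻¹ = 1 := by field_simp
        rw [this, one_smul]
    refine Set.mem_iUnion.2 ⟨j, ?_⟩
    rcases le_total 0 (x j) with h | h
    · exact Or.inl (key 1 (by rw [abs_of_nonneg h, one_mul]))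
    · exact Or.inr (key (-1) (by rw [abs_of_nonpos h]; ring))
  refine (measure_mono hcover).trans_lt ((measure_iUnion_le _).trans_lt ?_)
  rw [tsum_fintype]
  exact ENNReal.sum_lt_top.2 fun j _ => (measure_union_le _ _).trans_lt
    (ENNReal.add_lt_top.2 ⟨hfin j 1 one_ne_zero, hfin j (-1) (by norm_num)⟩)

section Rotation

variable {E : Type*} [NormedAddCommGroup E] [InnerProductSpace ℝ E] [FiniteDimensional ℝ E]
  [MeasurableSpace E] [BorelSpace E]

/-- A derivative of a `C¹` function along a continuous vector field is integrable on a sphere of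
finite Hausdorff measure. -/
theorem integrableOn_sphere_fderiv_apply {d r : ℝ} (hfin : μH[d] (Metric.sphere (0 : E) r) < ∞)
    {U : Set E} (hU : IsOpen U) (hsub : Metric.sphere (0 : E) r ⊆ U) {f : E → ℝ}
    (hf : ContDiffOn ℝ 1 f U) (K : E →L[ℝ] E) :
    IntegrableOn (fun x => fderiv ℝ f x (K x)) (Metric.sphere (0 : E) r) μH[d] :=
  ((((hf.continuousOn_fderiv_of_isOpen hU le_rfl).clm_apply
    K.continuous.continuousOn).mono hsub).integrableOn_of_subset_isCompact
      (isCompact_sphere 0 r) Metric.isClosed_sphere.measurableSet subset_rfl hfin.ne)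

/-- The derivative of a function along an infinitesimal rotation has vanishing integral over each
sphere centered at the origin. -/
theorem setIntegral_sphere_fderiv_skewAdjoint {d r : ℝ}
    (hfin : μH[d] (Metric.sphere (0 : E) r) < ∞)
    {U : Set E} (hU : IsOpen U) (hsub : Metric.sphere (0 : E) r ⊆ U) {f : E → ℝ}
    (hf : ContDiffOn ℝ 1 f U) {K : E →L[ℝ] E} (hK : K ∈ skewAdjoint (E →L[ℝ] E)) :
    ∫ x in Metric.sphere (0 : E) r, fderiv ℝ f x (K x) ∂μH[d] = 0 := by
  let +nondep : NormedAlgebra ℚ (E →L[ℝ] E) := .restrictScalars ℚ ℝ _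
  set S := Metric.sphere (0 : E) r with hS
  have hSm : MeasurableSet S := Metric.isClosed_sphere.measurableSet
  let R : ℝ → E →L[ℝ] E := fun t => NormedSpace.exp (t • K)
  have hR : ∀ t, R t ∈ unitary (E →L[ℝ] E) := fun t =>
    NormedSpace.exp_mem_unitary_of_mem_skewAdjoint (skewAdjoint.smul_mem t hK)
  let e : ℝ → E ≃ₗᵢ[ℝ] E := fun t => Unitary.linearIsometryEquiv ⟨R t, hR t⟩
  have he : ∀ t x, e t x = R t x := fun t x => rfl
  have hRn : ∀ t x, ‖R t x‖ = ‖x‖ := fun t x => (e t).norm_map x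
  have hRS : ∀ t, ∀ x ∈ S, R t x ∈ S := by
    intro t x hx
    simpa [hS, hRn] using hx
  have hR0 : R 0 = 1 := by simp [R]
  have hderiv : ∀ x ∈ S, ∀ t, HasDerivAt (fun t => f (R t x))
      (fderiv ℝ f (R t x) (K (R t x))) t := by
    intro x hx t
    have h1 : HasDerivAt (fun t => R t x) (K (R t x)) t :=
      (hasDerivAt_exp_smul_const' (𝕂 := ℝ) K t).clm_apply (hasDerivAt_const t x) |>.congr_deriv
        (by simp [R])
    have h2 : HasFDerivAt f (fderiv ℝ f (R t x)) (R t x) :=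
      ((hf.differentiableOn one_ne_zero).differentiableAt
        (hU.mem_nhds (hsub (hRS t x hx)))).hasFDerivAt
    exact h2.comp_hasDerivAt t h1
  have hcont : ContinuousOn (fun x => fderiv ℝ f x (K x)) S :=
    ((hf.continuousOn_fderiv_of_isOpen hU le_rfl).clm_apply K.continuous.continuousOn).mono hsub
  obtain ⟨C, hC⟩ := (isCompact_sphere (0 : E) r).exists_bound_of_continuousOn hcont
  have hfS : ContinuousOn f S := hf.continuousOn.mono hsub
  have hconst : ∀ t, ∫ x in S, f (R t x) ∂μH[d] = ∫ x in S, f x ∂μH[d] := by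
    intro t
    have h := ((e t).toIsometryEquiv.measurePreserving_hausdorffMeasure d).setIntegral_preimage_emb
      (e t).toHomeomorph.measurableEmbedding f S
    have hpre : (e t).toIsometryEquiv ⁻¹' S = S := by
      ext x
      simp [hS]
    rw [hpre] at h
    exact h
  have hmain := (hasDerivAt_integral_of_dominated_loc_of_deriv_le (μ := μH[d].restrict S)
    (F := fun t x => f (R t x)) (F' := fun t x => fderiv ℝ f (R t x) (K (R t x)))
    (x₀ := (0 : ℝ)) (s := Set.univ) (bound := fun _ => C) Filter.univ_mem
    (Filter.Eventually.of_forall fun t =>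
      (hfS.comp (R t).continuous.continuousOn (hRS t)).aestronglyMeasurable hSm)
    (by
      simpa [hR0, IntegrableOn] using hfS.integrableOn_of_subset_isCompact
        (isCompact_sphere 0 r) hSm subset_rfl hfin.ne)
    (by simpa [hR0] using hcont.aestronglyMeasurable hSm)
    ((ae_restrict_iff' hSm).2 <| Filter.Eventually.of_forall fun x hx t _ => hC _ (hRS t x hx))
    (integrableOn_const hfin.ne)
    ((ae_restrict_iff' hSm).2 <| Filter.Eventually.of_forall fun x hx t _ => hderiv x hx t)).2
  simp only [hconst, hR0, one_apply_eq_self] at hmain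
  exact hmain.unique (hasDerivAt_const _ _)

end Rotation

/-- The infinitesimal rotation `x ↦ x i • e j - x j • e i` in a coordinate plane. -/
noncomputable def planeRotation {n : ℕ} (i j : Fin n) :
    EuclideanSpace ℝ (Fin n) →L[ℝ] EuclideanSpace ℝ (Fin n) :=
  (EuclideanSpace.proj i).smulRight (EuclideanSpace.single j 1) -
    (EuclideanSpace.proj j).smulRight (EuclideanSpace.single i 1)

theorem planeRotation_apply {n : ℕ} (i j : Fin n) (x : EuclideanSpace ℝ (Fin n)) :
    planeRotation i j x =
      x i • EuclideanSpace.single j (1 : ℝ) - x j • EuclideanSpace.single i (1 : ℝ) := by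
  simp [planeRotation]

theorem planeRotation_mem_skewAdjoint {n : ℕ} (i j : Fin n) :
    planeRotation i j ∈
      skewAdjoint (EuclideanSpace ℝ (Fin n) →L[ℝ] EuclideanSpace ℝ (Fin n)) := by
  rw [skewAdjoint.mem_iff, ContinuousLinearMap.star_eq_adjoint]
  refine ((ContinuousLinearMap.eq_adjoint_iff _ _).2 fun x y => ?_).symm
  simp only [neg_apply, planeRotation_apply, inner_neg_left, inner_sub_left,
    inner_sub_right, inner_smul_left, inner_smul_right, EuclideanSpace.inner_single_left,
    EuclideanSpace.inner_single_right, map_one, one_mul, conj_trivial]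
  ring

/-- The divergence of a vector field tangential to the spheres centered at the origin is a sum of
derivatives along infinitesimal rotations. -/
theorem sum_fderiv_planeRotation {n : ℕ}
    {A : EuclideanSpace ℝ (Fin n) → EuclideanSpace ℝ (Fin n)} {x : EuclideanSpace ℝ (Fin n)}
    (hA : DifferentiableAt ℝ A x) (htang : ∀ᶠ y in nhds x, ∑ j : Fin n, y j * A y j = 0) :
    ∑ i : Fin n, ∑ j : Fin n,
        fderiv ℝ (fun y => y i * A y j - y j * A y i) x (planeRotation i j x) =
      2 * ‖x‖ ^ 2 *
        ∑ j : Fin n, fderiv ℝ (fun y => A y j) x (EuclideanSpace.single j 1) := by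
  have hAj : ∀ j, DifferentiableAt ℝ (fun y => A y j) x := differentiableAt_euclidean.1 hA
  have hxj : ∀ j : Fin n, HasFDerivAt (fun y : EuclideanSpace ℝ (Fin n) => y j)
      (EuclideanSpace.proj j : EuclideanSpace ℝ (Fin n) →L[ℝ] ℝ) x := fun j =>
    (EuclideanSpace.proj j : EuclideanSpace ℝ (Fin n) →L[ℝ] ℝ).hasFDerivAt
  set a : Fin n → Fin n → ℝ :=
    fun i j => fderiv ℝ (fun y => A y j) x (EuclideanSpace.single i 1) with ha
  have hprod : ∀ i j, HasFDerivAt (fun y => y i * A y j) _ x := fun i j =>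
    (hxj i).mul (hAj j).hasFDerivAt
  have hx0 : ∑ j, x j * A x j = 0 := htang.self_of_nhds
  have hrad : ∀ k, ∑ j, x j * a k j = - A x k := by
    intro k
    have h1 := HasFDerivAt.fun_sum (u := Finset.univ) fun j _ => hprod j j
    have h2 := h1.unique ((hasFDerivAt_const (0 : ℝ) x).congr_of_eventuallyEq htang)
    have h3 := DFunLike.congr_fun h2 (EuclideanSpace.single k 1)
    simp [Finset.sum_add_distrib, PiLp.single_apply] at h3
    linarith
  have hterm : ∀ i j, fderiv ℝ (fun y => y i * A y j - y j * A y i) x (planeRotation i j x) =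
      (if i = j then 2 * (x i * A x j) else 0) - x i * A x i - x j * A x j
        + (x i ^ 2 * a j j + x j ^ 2 * a i i) - x j * (x i * a j i) - x i * (x j * a i j) := by
    intro i j
    rw [((hprod i j).fun_sub (hprod j i)).fderiv, planeRotation_apply]
    rcases eq_or_ne i j with rfl | hij
    · simp
      ring
    · simp [hij, hij.symm]
      ring
  have hcross : ∑ i, ∑ j, x i * (x j * a i j) = 0 := by
    simp only [← Finset.mul_sum, hrad, mul_neg, Finset.sum_neg_distrib, hx0, neg_zero]
  have hcross' : ∑ i, ∑ j, x j * (x i * a j i) = 0 := by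
    rw [Finset.sum_comm, hcross]
  have hdiv : ∑ i, ∑ j, x i ^ 2 * a j j = ‖x‖ ^ 2 * ∑ j, a j j := by
    rw [EuclideanSpace.real_norm_sq_eq, Finset.sum_mul_sum]
  have hdiv' : ∑ i, ∑ j, x j ^ 2 * a i i = ‖x‖ ^ 2 * ∑ j, a j j := by
    rw [Finset.sum_comm, hdiv]
  simp only [hterm, Finset.sum_sub_distrib, Finset.sum_add_distrib, hcross, hcross', hdiv, hdiv']
  simp only [Finset.sum_ite_eq, Finset.mem_univ, if_true, Finset.sum_const, ← Finset.smul_sum,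
    ← Finset.mul_sum, hx0]
  simp only [smul_zero, mul_zero, ha]
  ring

/-- Key observation in the proof of Lemma A.2: a `C¹` vector field that is everywhere
tangential to spheres centered at the origin (on a neighborhood of the sphere of radius `r`)
has vanishing total divergence flux through that sphere. -/
theorem stmt2 {n : ℕ} (hn : 2 ≤ n) (r : ℝ) (hr : 0 < r)
    (A : EuclideanSpace ℝ (Fin n) → EuclideanSpace ℝ (Fin n))
    (U : Set (EuclideanSpace ℝ (Fin n))) (hU : IsOpen U)
    (hsub : Metric.sphere (0 : EuclideanSpace ℝ (Fin n)) r ⊆ U)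
    (hA : ContDiffOn ℝ 1 A U)
    (htang : ∀ x ∈ U, ∑ j : Fin n, x j * A x j = 0) :
    ∫ x in Metric.sphere (0 : EuclideanSpace ℝ (Fin n)) r,
        (∑ j : Fin n, fderiv ℝ (fun y => A y j) x (EuclideanSpace.single j 1))
      ∂(μH[(n : ℝ) - 1]) = 0 := by
  have hfin : μH[(n : ℝ) - 1] (Metric.sphere (0 : EuclideanSpace ℝ (Fin n)) r) < ∞ := by
    obtain ⟨m, rfl⟩ : ∃ m, n = m + 1 := ⟨n - 1, by omega⟩
    simpa using hausdorffMeasure_sphere_lt_top m hr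
  have hAj : ∀ j, ContDiffOn ℝ 1 (fun y => A y j) U := contDiffOn_euclidean.1 hA
  have hB : ∀ i j : Fin n, ContDiffOn ℝ 1 (fun y => y i * A y j - y j * A y i) U := fun i j =>
    ((contDiff_euclidean.1 contDiff_id i).contDiffOn.mul (hAj j)).sub
      ((contDiff_euclidean.1 contDiff_id j).contDiffOn.mul (hAj i))
  have hsum : ∫ x in Metric.sphere (0 : EuclideanSpace ℝ (Fin n)) r,
      (∑ i : Fin n, ∑ j : Fin n,
        fderiv ℝ (fun y => y i * A y j - y j * A y i) x (planeRotation i j x))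
      ∂(μH[(n : ℝ) - 1]) = 0 := by
    have hint := fun i j =>
      integrableOn_sphere_fderiv_apply hfin hU hsub (hB i j) (planeRotation i j)
    rw [integral_finsetSum _ fun i _ => integrable_finsetSum _ fun j _ => hint i j]
    refine Finset.sum_eq_zero fun i _ => ?_
    rw [integral_finsetSum _ fun j _ => hint i j]
    exact Finset.sum_eq_zero fun j _ => setIntegral_sphere_fderiv_skewAdjoint hfin hU hsub
      (hB i j) (planeRotation_mem_skewAdjoint i j)
  have hcongr := setIntegral_congr_fun (μ := μH[(n : ℝ) - 1])
    (Metric.isClosed_sphere (x := (0 : EuclideanSpace ℝ (Fin n))) (ε := r)).measurableSet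
    fun x hx => (sum_fderiv_planeRotation
      ((hA.differentiableOn one_ne_zero).differentiableAt (hU.mem_nhds (hsub hx)))
      (Filter.mem_of_superset (hU.mem_nhds (hsub hx)) htang)).trans
        (by rw [mem_sphere_zero_iff_norm.1 hx] :
          _ = 2 * r ^ 2 *
            ∑ j : Fin n, fderiv ℝ (fun y => A y j) x (EuclideanSpace.single j 1))
  rw [hcongr, integral_const_mul] at hsum
  exact (mul_eq_zero.1 hsum).resolve_left (by positivity)
end

section
/- Let n ≥ 1, let q' ∈ ℝ, α ∈ (0,1], and a > 1. For every ε > 0 there exists a constant C(ε) > 0, depending only on n, q', α, a, and ε, with the following property: for every continuous function u on Ω = {x ∈ ℝⁿ : |x| ≥ 1} whose weighted Hölder seminorm S := sup { |x|^{q'+α} |u(x) − u(y)| / |x−y|^α : x, y ∈ Ω, 0 < |x−y| ≤ |x|/2 } and weighted Lᵃ norm N := ( ∫_Ω ( |x|^{q'} |u(x)| )ᵃ |x|^{−n} dx )^{1/a} are both finite, one has sup_{x ∈ Ω} |x|^{q'} |u(x)| ≤ ε S + C(ε) N. -/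
open MeasureTheory

lemma two_rpow_neg_abs_mul_rpow_le {r s q : ℝ} (hr : 0 < r) (hrs : r ≤ s) (hs : s ≤ 2 * r) :
    (2 : ℝ) ^ (-|q|) * r ^ q ≤ s ^ q := by
  have h1 : 1 ≤ s / r := (one_le_div hr).2 hrs
  have h2 : s / r ≤ 2 := (div_le_iff₀ hr).2 hs
  have key : (2 : ℝ) ^ (-|q|) ≤ (s / r) ^ q :=
    calc (2 : ℝ) ^ (-|q|) ≤ (s / r) ^ (-|q|) :=
          Real.rpow_le_rpow_of_nonpos (by linarith) h2 (by simp)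
      _ ≤ (s / r) ^ q := Real.rpow_le_rpow_of_exponent_le h1 (neg_abs_le q)
  calc (2 : ℝ) ^ (-|q|) * r ^ q ≤ (s / r) ^ q * r ^ q := by gcongr
    _ = s ^ q := by
      rw [← Real.mul_rpow (by positivity) hr.le, div_mul_cancel₀ _ hr.ne']

section Ball

variable {E : Type*} [NormedAddCommGroup E] [NormedSpace ℝ E]

/-- The ball of radius `δ ‖x‖ / 2` around `(1 + δ / 2) x` touches the sphere through `x` from
outside. -/
lemma bounds_of_mem_ball_outside {δ : ℝ} (hδ : 0 ≤ δ) (hδ' : δ ≤ 1 / 2) {x y : E}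
    (hy : y ∈ Metric.ball ((1 + δ / 2) • x) (δ / 2 * ‖x‖)) :
    ‖x‖ ≤ ‖y‖ ∧ ‖y‖ ≤ 2 * ‖x‖ ∧ ‖x - y‖ ≤ δ * ‖x‖ := by
  rw [mem_ball_iff_norm] at hy
  have hz : ‖(1 + δ / 2) • x‖ = (1 + δ / 2) * ‖x‖ := by
    rw [norm_smul, Real.norm_of_nonneg (by linarith)]
  have hxz : ‖x - (1 + δ / 2) • x‖ = δ / 2 * ‖x‖ := by
    have : x - (1 + δ / 2) • x = (-(δ / 2)) • x := by module
    rw [this, norm_smul, norm_neg, Real.norm_of_nonneg (by linarith)]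
  have h1 := norm_sub_norm_le ((1 + δ / 2) • x) y
  rw [norm_sub_rev] at h1
  have h2 := norm_sub_norm_le y ((1 + δ / 2) • x)
  have h3 := norm_sub_le_norm_sub_add_norm_sub x ((1 + δ / 2) • x) y
  rw [norm_sub_rev ((1 + δ / 2) • x) y] at h3
  have h4 : δ * ‖x‖ ≤ 1 / 2 * ‖x‖ := by gcongr
  have := norm_nonneg x
  refine ⟨by linarith, by linarith, by linarith⟩

end Ball

/-- A weighted Hölder bound controls the weighted oscillation on relative scale `δ`. -/
lemma weighted_le_add_of_holder {r d q α ε S A B δ : ℝ} (hr : 0 < r) (hd : 0 ≤ d)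
    (hα : 0 < α) (hS : 0 ≤ S) (hδ : 0 ≤ δ) (hδε : δ ^ α ≤ ε) (hdr : d ≤ δ * r)
    (h : r ^ (q + α) * |A - B| ≤ S * d ^ α) :
    r ^ q * |A| ≤ ε * S + r ^ q * |B| := by
  have h1 : r ^ q * |A - B| * r ^ α ≤ ε * S * r ^ α :=
    calc r ^ q * |A - B| * r ^ α = r ^ (q + α) * |A - B| := by
          rw [Real.rpow_add hr]; ring
      _ ≤ S * d ^ α := h
      _ ≤ S * (δ * r) ^ α := by gcongr
      _ = S * (δ ^ α * r ^ α) := by rw [Real.mul_rpow hδ hr.le]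
      _ ≤ S * (ε * r ^ α) := by gcongr
      _ = ε * S * r ^ α := by ring
  have h2 : r ^ q * |A - B| ≤ ε * S := le_of_mul_le_mul_right h1 (by positivity)
  have h3 : |A| ≤ |A - B| + |B| := by
    simpa using abs_add_le (A - B) B
  calc r ^ q * |A| ≤ r ^ q * (|A - B| + |B|) := by gcongr
    _ ≤ ε * S + r ^ q * |B| := by rw [mul_add]; gcongr

/-- Weighted interpolation inequality from the proof of Proposition B.2: for every `ε > 0`
there is `C(ε) > 0` such that for every continuous `u` on the exterior region with finite
weighted Hölder seminorm `S` and weighted `Lᵃ` norm `N`, one has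
`sup |x|^{q'}|u(x)| ≤ ε S + C(ε) N`. -/
theorem stmt10 {n : ℕ} (hn : 1 ≤ n) (q' α a : ℝ) (hα : 0 < α) (hα1 : α ≤ 1) (ha : 1 < a)
    (ε : ℝ) (hε : 0 < ε) :
    ∃ C : ℝ, 0 < C ∧
      ∀ (u : EuclideanSpace ℝ (Fin n) → ℝ) (S N : ℝ),
        ContinuousOn u {x : EuclideanSpace ℝ (Fin n) | 1 ≤ ‖x‖} →
        -- `S` bounds the weighted Hölder seminorm
        (∀ x y : EuclideanSpace ℝ (Fin n), 1 ≤ ‖x‖ → 1 ≤ ‖y‖ →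
          0 < ‖x - y‖ → ‖x - y‖ ≤ ‖x‖ / 2 →
          ‖x‖ ^ (q' + α) * |u x - u y| ≤ S * ‖x - y‖ ^ α) →
        -- the weighted `Lᵃ` integrand is integrable with norm `N`
        IntegrableOn (fun x : EuclideanSpace ℝ (Fin n) =>
            (‖x‖ ^ q' * |u x|) ^ a * ‖x‖ ^ (-(n : ℝ)))
          {x : EuclideanSpace ℝ (Fin n) | 1 ≤ ‖x‖} →
        N = (∫ x in {x : EuclideanSpace ℝ (Fin n) | 1 ≤ ‖x‖},
            (‖x‖ ^ q' * |u x|) ^ a * ‖x‖ ^ (-(n : ℝ))) ^ (1 / a) →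
        ∀ x : EuclideanSpace ℝ (Fin n), 1 ≤ ‖x‖ →
          ‖x‖ ^ q' * |u x| ≤ ε * S + C * N := by
  obtain ⟨δ, hδ, hδ', hδε⟩ : ∃ δ : ℝ, 0 < δ ∧ δ ≤ 1 / 2 ∧ δ ^ α ≤ ε := by
    refine ⟨min (1 / 2) (ε ^ (1 / α)), by positivity, min_le_left _ _, ?_⟩
    calc (min (1 / 2) (ε ^ (1 / α))) ^ α ≤ (ε ^ (1 / α)) ^ α := by
          gcongr
          exact min_le_right _ _
      _ = ε := by rw [← Real.rpow_mul hε.le, one_div_mul_cancel hα.ne', Real.rpow_one]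
  set ω : ℝ := volume.real (Metric.ball (0 : EuclideanSpace ℝ (Fin n)) 1) with hω
  have hω0 : 0 < ω :=
    ENNReal.toReal_pos (Metric.measure_ball_pos _ _ one_pos).ne' measure_ball_lt_top.ne
  set k : ℝ := (2 : ℝ) ^ (-|q'|) with hk
  have hk0 : 0 < k := by positivity
  set c : ℝ := (δ / 4) ^ n * ω with hc
  have hc0 : 0 < c := by positivity
  refine ⟨(k * c ^ (1 / a))⁻¹, by positivity, ?_⟩
  intro u S N _ hH hI hN x hx
  have hx0 : 0 < ‖x‖ := by linarith
  have hS : 0 ≤ S := by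
    have hd : ‖x - (3 / 2 : ℝ) • x‖ = ‖x‖ / 2 := by
      have : x - (3 / 2 : ℝ) • x = (-(1 / 2) : ℝ) • x := by module
      rw [this, norm_smul]; norm_num; ring
    have h := hH x ((3 / 2 : ℝ) • x) hx (by rw [norm_smul]; norm_num; linarith)
      (by rw [hd]; positivity) hd.le
    rw [hd] at h
    exact nonneg_of_mul_nonneg_left ((by positivity : (0 : ℝ) ≤ _).trans h) (by positivity)
  have hΩ : MeasurableSet {x : EuclideanSpace ℝ (Fin n) | 1 ≤ ‖x‖} :=
    measurableSet_le measurable_const measurable_norm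
  have hN0 : 0 ≤ N := by
    rw [hN]
    exact Real.rpow_nonneg (integral_nonneg fun y => by positivity) _
  set M : ℝ := ‖x‖ ^ q' * |u x| - ε * S with hM
  rcases le_or_gt M 0 with hM0 | hM0
  · have : 0 ≤ (k * c ^ (1 / a))⁻¹ * N := by positivity
    linarith
  set B := Metric.ball ((1 + δ / 2) • x) (δ / 2 * ‖x‖) with hB
  have hBΩ : B ⊆ {x : EuclideanSpace ℝ (Fin n) | 1 ≤ ‖x‖} := fun y hy =>
    hx.trans (bounds_of_mem_ball_outside hδ.le hδ' hy).1
  have hlow : ∀ y ∈ B, (M * k) ^ a * (2 * ‖x‖) ^ (-(n : ℝ)) ≤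
      (‖y‖ ^ q' * |u y|) ^ a * ‖y‖ ^ (-(n : ℝ)) := by
    intro y hy
    obtain ⟨h1, h2, h3⟩ := bounds_of_mem_ball_outside hδ.le hδ' hy
    have hy0 : 0 < ‖y‖ := by linarith
    have hosc : ‖x‖ ^ q' * |u x| ≤ ε * S + ‖x‖ ^ q' * |u y| := by
      refine weighted_le_add_of_holder hx0 (norm_nonneg (x - y)) hα hS hδ.le hδε h3 ?_
      rcases eq_or_ne x y with rfl | hxy
      · simp [Real.zero_rpow hα.ne']
      · exact hH x y hx (by linarith) (norm_pos_iff.2 (sub_ne_zero.2 hxy))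
          (h3.trans (by nlinarith))
    have hMk : M * k ≤ ‖y‖ ^ q' * |u y| :=
      calc M * k ≤ ‖x‖ ^ q' * |u y| * k := by gcongr; linarith
        _ = k * ‖x‖ ^ q' * |u y| := by ring
        _ ≤ ‖y‖ ^ q' * |u y| := by
          gcongr
          exact two_rpow_neg_abs_mul_rpow_le hx0 h1 h2
    have hpow : (2 * ‖x‖) ^ (-(n : ℝ)) ≤ ‖y‖ ^ (-(n : ℝ)) :=
      Real.rpow_le_rpow_of_nonpos hy0 h2 (by simp)
    gcongr
  have hvol : volume.real B = (δ / 2 * ‖x‖) ^ n * ω := by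
    rw [hB, hω, measureReal_def, measureReal_def, Measure.addHaar_ball_of_pos _ _ (by positivity),
      finrank_euclideanSpace_fin, ENNReal.toReal_mul, ENNReal.toReal_ofReal (by positivity)]
  have hint : (M * k) ^ a * c ≤ ∫ y in {x : EuclideanSpace ℝ (Fin n) | 1 ≤ ‖x‖},
      (‖y‖ ^ q' * |u y|) ^ a * ‖y‖ ^ (-(n : ℝ)) :=
    calc (M * k) ^ a * c = (M * k) ^ a * (2 * ‖x‖) ^ (-(n : ℝ)) * volume.real B := by
          rw [hvol, hc, Real.rpow_neg (by positivity), Real.rpow_natCast, div_pow, mul_pow,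
            mul_pow, div_pow, show (4 : ℝ) = 2 * 2 by norm_num, mul_pow]
          field_simp
      _ ≤ ∫ y in B, (‖y‖ ^ q' * |u y|) ^ a * ‖y‖ ^ (-(n : ℝ)) :=
          setIntegral_ge_of_const_le_real measurableSet_ball measure_ball_lt_top.ne hlow
            (hI.mono_set hBΩ)
      _ ≤ _ := setIntegral_mono_set hI
          (Filter.Eventually.of_forall fun y => by positivity) hBΩ.eventuallyLE
  have hMN : M * (k * c ^ (1 / a)) ≤ N := by
    have ha0 : 0 < a := by linarith
    calc M * (k * c ^ (1 / a)) = ((M * k) ^ a * c) ^ (1 / a) := by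
          rw [Real.mul_rpow (by positivity) hc0.le, ← Real.rpow_mul (by positivity),
            mul_one_div_cancel ha0.ne', Real.rpow_one, mul_assoc]
      _ ≤ N := by
          rw [hN]
          gcongr
  have : M ≤ (k * c ^ (1 / a))⁻¹ * N := by
    rw [inv_mul_eq_div, le_div_iff₀ (by positivity)]
    exact hMN
  linarith
end
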